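/- The system K^{∇•} is sound and strongly complete with respect to the class of filters: for every set Γ ∪ {φ} of L(∇,•)-formulas, Γ ⊢_{K^{∇•}} φ if and only if every pointed model (M,s) with M a filter satisfying all members of Γ also satisfies φ. -/

import Mathlib

/-- The language L(∇,•) over propositional variables indexed by ℕ. -/
inductive Formula : Type
  | atom : ℕ → Formula
  | neg : Formula → Formula
  | and : Formula → Formula → Formula
  | nabla : Formula → Formula
  | bullet : Formula → Formula

namespace Formula

/-- Disjunction, defined from ¬ and ∧ as usual. -/
def or (φ ψ : Formula) : Formula := neg ((neg φ).and (neg ψ))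

/-- Implication, defined from ¬ and ∧ as usual. -/
def imp (φ ψ : Formula) : Formula := (neg φ).or ψ

/-- Biimplication, defined from ¬ and ∧ as usual. -/
def biimp (φ ψ : Formula) : Formula := (φ.imp ψ).and (ψ.imp φ)

/-- A fixed tautology ⊤. -/
def top : Formula := (atom 0).imp (atom 0)

/-- Δφ := ¬∇φ. -/
def delta (φ : Formula) : Formula := neg (nabla φ)

/-- ∘φ := ¬•φ. -/
def circ (φ : Formula) : Formula := neg (bullet φ)

end Formula

/-- A neighborhood model. -/
structure NbhdModel : Type 1 where
  S : Type
  ne : Nonempty S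
  N : S → Set (Set S)
  V : ℕ → Set S

namespace NbhdModel

/-- The truth set ⟦φ⟧_M of a formula in a neighborhood model. -/
def truthSet (M : NbhdModel) : Formula → Set M.S
  | .atom p => M.V p
  | .neg φ => (M.truthSet φ)ᶜ
  | .and φ ψ => M.truthSet φ ∩ M.truthSet ψ
  | .nabla φ => {s | M.truthSet φ ∉ M.N s ∧ (M.truthSet φ)ᶜ ∉ M.N s}
  | .bullet φ => {s | s ∈ M.truthSet φ ∧ M.truthSet φ ∉ M.N s}

/-- M,s ⊨ φ. -/
def Sat (M : NbhdModel) (s : M.S) (φ : Formula) : Prop := s ∈ M.truthSet φ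

/-- Property (n): N(s) contains the unit. -/
def PropN (M : NbhdModel) : Prop := ∀ s : M.S, (Set.univ : Set M.S) ∈ M.N s

/-- Property (r): N(s) contains its core. -/
def PropR (M : NbhdModel) : Prop := ∀ s : M.S, ⋂₀ (M.N s) ∈ M.N s

/-- Property (i): N(s) is closed under binary intersections. -/
def PropI (M : NbhdModel) : Prop :=
  ∀ (s : M.S) (X Y : Set M.S), X ∈ M.N s → Y ∈ M.N s → X ∩ Y ∈ M.N s

/-- Property (s): N(s) is supplemented (closed under supersets). -/
def PropS (M : NbhdModel) : Prop :=
  ∀ (s : M.S) (X Y : Set M.S), X ∈ M.N s → X ⊆ Y → Y ∈ M.N s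

/-- Property (c): N(s) is closed under complements. -/
def PropC (M : NbhdModel) : Prop :=
  ∀ (s : M.S) (X : Set M.S), X ∈ M.N s → Xᶜ ∈ M.N s

/-- Property (d). -/
def PropD (M : NbhdModel) : Prop :=
  ∀ (s : M.S) (X : Set M.S), X ∈ M.N s → Xᶜ ∉ M.N s

/-- Property (t). -/
def PropT (M : NbhdModel) : Prop :=
  ∀ (s : M.S) (X : Set M.S), X ∈ M.N s → s ∈ X

/-- Property (b). -/
def PropB (M : NbhdModel) : Prop :=
  ∀ (s : M.S) (X : Set M.S), s ∈ X → {u : M.S | Xᶜ ∉ M.N u} ∈ M.N s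

/-- Property (4). -/
def Prop4 (M : NbhdModel) : Prop :=
  ∀ (s : M.S) (X : Set M.S), X ∈ M.N s → {u : M.S | X ∈ M.N u} ∈ M.N s

/-- Property (5). -/
def Prop5 (M : NbhdModel) : Prop :=
  ∀ (s : M.S) (X : Set M.S), X ∉ M.N s → {u : M.S | X ∉ M.N u} ∈ M.N s

end NbhdModel

/-- φ is an instance of a propositional tautology (treating ∇ψ and •ψ subformulas
as atoms): every Boolean valuation that respects ¬ and ∧ makes φ true. -/
def IsTautology (φ : Formula) : Prop :=
  ∀ v : Formula → Bool,
    (∀ ψ : Formula, v ψ.neg = !v ψ) →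
    (∀ ψ χ : Formula, v (ψ.and χ) = (v ψ && v χ)) →
    v φ = true

/-- Theorems of the system E^{∇•} extended with the extra axioms in `Ax`:
all tautology instances, E1, E2, E3, the members of `Ax`, closed under
modus ponens, RE∇ and RE•. -/
inductive Prf (Ax : Set Formula) : Formula → Prop
  | taut {φ : Formula} : IsTautology φ → Prf Ax φ
  | e1 (φ : Formula) : Prf Ax ((Formula.nabla φ).biimp (Formula.nabla φ.neg))
  | e2 (φ : Formula) : Prf Ax ((Formula.bullet φ).imp φ)
  | e3 (φ : Formula) :
      Prf Ax ((Formula.nabla φ).imp ((Formula.bullet φ).or (Formula.bullet φ.neg)))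
  | ax {φ : Formula} : φ ∈ Ax → Prf Ax φ
  | mp {φ ψ : Formula} : Prf Ax (φ.imp ψ) → Prf Ax φ → Prf Ax ψ
  | reN {φ ψ : Formula} :
      Prf Ax (φ.biimp ψ) → Prf Ax ((Formula.nabla φ).biimp (Formula.nabla ψ))
  | reB {φ ψ : Formula} :
      Prf Ax (φ.biimp ψ) → Prf Ax ((Formula.bullet φ).biimp (Formula.bullet ψ))

/-- Γ ⊢_Λ φ: derivable from theorems of the system together with members of Γ
by modus ponens. -/
inductive Deriv (Ax : Set Formula) (Γ : Set Formula) : Formula → Prop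
  | thm {φ : Formula} : Prf Ax φ → Deriv Ax Γ φ
  | prem {φ : Formula} : φ ∈ Γ → Deriv Ax Γ φ
  | mp {φ ψ : Formula} : Deriv Ax Γ (φ.imp ψ) → Deriv Ax Γ φ → Deriv Ax Γ ψ

/-- No extra axioms: the system E^{∇•}. -/
def EAx : Set Formula := ∅

/-- Extra axiom E4: •φ → ∇φ (all instances); E^{∇•} plus these is E_c^{∇•}. -/
def EcAx : Set Formula := {α | ∃ φ : Formula, α = (Formula.bullet φ).imp (Formula.nabla φ)}

/-- Extra axiom ∘⊤; E^{∇•} plus this is EN^{∇•}. -/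
def ENAx : Set Formula := {Formula.top.bullet.neg}

/-- Extra axioms M1–M4 (all instances); E^{∇•} plus these is M^{∇•}. -/
def MAx : Set Formula :=
  {α | ∃ φ ψ χ : Formula,
      α = ((Formula.nabla (φ.or ψ)).and (Formula.nabla (φ.neg.or χ))).imp (Formula.nabla φ)} ∪
  {α | ∃ φ ψ χ : Formula,
      α = ((Formula.bullet (φ.or ψ)).and (Formula.bullet (φ.neg.or χ))).imp (Formula.nabla φ)} ∪
  {α | ∃ φ ψ χ : Formula,
      α = ((Formula.bullet (φ.or ψ)).and (Formula.nabla (φ.neg.or χ))).imp (Formula.nabla φ)} ∪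
  {α | ∃ φ ψ : Formula,
      α = (φ.circ.and φ).imp ((Formula.delta (φ.or ψ)).and (Formula.circ (φ.or ψ)))}

/-- Extra axioms of R^{∇•}: those of M^{∇•} plus R1 and R2 (all instances). -/
def RAx : Set Formula :=
  MAx ∪
  {α | ∃ φ ψ : Formula,
      α = ((Formula.delta φ).and (Formula.delta ψ)).imp (Formula.delta (φ.and ψ))} ∪
  {α | ∃ φ ψ : Formula,
      α = ((Formula.circ φ).and (Formula.circ ψ)).imp (Formula.circ (φ.and ψ))}

/-- Extra axioms of K^{∇•}: those of R^{∇•} plus ∘⊤. -/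
def KAx : Set Formula := RAx ∪ {Formula.top.bullet.neg}

namespace Deriv

variable {Ax Γ Δ : Set Formula} {φ ψ : Formula}

theorem mono (h : Γ ⊆ Δ) (d : Deriv Ax Γ φ) : Deriv Ax Δ φ := by
  induction d with
  | thm h => exact .thm h
  | prem hm => exact .prem (h hm)
  | mp _ _ ih₁ ih₂ => exact .mp ih₁ ih₂

theorem prf (d : Deriv Ax ∅ φ) : Prf Ax φ := by
  induction d with
  | thm h => exact h
  | prem hm => exact hm.elim
  | mp _ _ ih₁ ih₂ => exact .mp ih₁ ih₂

theorem of_isTautology (h : IsTautology φ) : Deriv Ax Γ φ := .thm (.taut h)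

theorem of_insert (d : Deriv Ax (insert φ Γ) ψ) : Deriv Ax Γ (φ.imp ψ) := by
  induction d with
  | @thm χ h =>
    refine .mp (of_isTautology (φ := χ.imp (φ.imp χ)) ?_) (.thm h)
    intro v hn ha
    simp only [Formula.imp, Formula.or, hn, ha]
    cases v φ <;> cases v χ <;> rfl
  | @prem χ hm =>
    rcases hm with rfl | hm
    · refine of_isTautology ?_
      intro v hn ha
      simp only [Formula.imp, Formula.or, hn, ha]
      cases v χ <;> rfl
    · refine .mp (of_isTautology (φ := χ.imp (φ.imp χ)) ?_) (.prem hm)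
      intro v hn ha
      simp only [Formula.imp, Formula.or, hn, ha]
      cases v φ <;> cases v χ <;> rfl
  | @mp χ θ _ _ ih₁ ih₂ =>
    refine .mp (.mp (of_isTautology
      (φ := (φ.imp (χ.imp θ)).imp ((φ.imp χ).imp (φ.imp θ))) ?_) ih₁) ih₂
    intro v hn ha
    simp only [Formula.imp, Formula.or, hn, ha]
    cases v φ <;> cases v χ <;> cases v θ <;> rfl

theorem exists_of_sUnion {c : Set (Set Formula)} (hc : IsChain (· ⊆ ·) c) (hne : c.Nonempty)
    (d : Deriv Ax (⋃₀ c) φ) : ∃ Δ ∈ c, Deriv Ax Δ φ := by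
  induction d with
  | thm h =>
    obtain ⟨Δ, hΔ⟩ := hne
    exact ⟨Δ, hΔ, .thm h⟩
  | prem hm =>
    obtain ⟨Δ, hΔ, hm⟩ := hm
    exact ⟨Δ, hΔ, .prem hm⟩
  | mp _ _ ih₁ ih₂ =>
    obtain ⟨Δ₁, h₁, d₁⟩ := ih₁
    obtain ⟨Δ₂, h₂, d₂⟩ := ih₂
    rcases hc.total h₁ h₂ with h | h
    · exact ⟨Δ₂, h₂, .mp (d₁.mono h) d₂⟩
    · exact ⟨Δ₁, h₁, .mp d₁ (d₂.mono h)⟩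

end Deriv

/-- The maximal consistent sets of the system with extra axioms `Ax`. -/
structure MaxConsistent (Ax : Set Formula) : Type where
  carrier : Set Formula
  mem_of_deriv : ∀ {φ}, Deriv Ax carrier φ → φ ∈ carrier
  neg_mem : ∀ {φ : Formula}, φ.neg ∈ carrier ↔ φ ∉ carrier

namespace MaxConsistent

variable {Ax : Set Formula} {φ ψ : Formula}

/-- Lindenbaum's lemma. -/
theorem exists_of_not_deriv {Γ : Set Formula} (h : ¬ Deriv Ax Γ φ) :
    ∃ w : MaxConsistent Ax, Γ ⊆ w.carrier ∧ φ ∉ w.carrier := by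
  obtain ⟨Δ, hΓ, hmax⟩ := zorn_subset_nonempty {Δ | ¬ Deriv Ax Δ φ}
    (fun c hc hchain hne => ⟨⋃₀ c, fun d => by
      obtain ⟨Δ, hΔ, d⟩ := d.exists_of_sUnion hchain hne
      exact hc hΔ d, fun _ => Set.subset_sUnion_of_mem⟩) Γ h
  have hΔ : ¬ Deriv Ax Δ φ := hmax.prop
  have himp : ∀ {ψ}, ψ ∉ Δ → Deriv Ax Δ (ψ.imp φ) := fun {ψ} hψ => by
    by_contra hd
    refine hψ (hmax.le_of_ge (y := insert ψ Δ) (fun d => hd d.of_insert)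
      (Set.subset_insert _ _) (Set.mem_insert _ _))
  refine ⟨⟨Δ, fun {ψ} d => ?_, fun {ψ} => ⟨fun hn hψ => hΔ ?_, fun hψ => ?_⟩⟩, hΓ,
    fun hφ => hΔ (.prem hφ)⟩
  · by_contra hψ
    exact hΔ (.mp (himp hψ) d)
  · refine .mp (.mp (.of_isTautology (φ := ψ.imp (ψ.neg.imp φ)) ?_) (.prem hψ)) (.prem hn)
    intro v hn ha
    simp only [Formula.imp, Formula.or, hn, ha]
    cases v φ <;> cases v ψ <;> rfl
  · by_contra hn
    refine hΔ (.mp (.mp (.of_isTautology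
      (φ := (ψ.imp φ).imp ((ψ.neg.imp φ).imp φ)) ?_) (himp hψ)) (himp hn))
    intro v hn ha
    simp only [Formula.imp, Formula.or, hn, ha]
    cases v φ <;> cases v ψ <;> rfl

variable (w : MaxConsistent Ax)

theorem mem_of_prf (h : Prf Ax φ) : φ ∈ w.carrier := w.mem_of_deriv (.thm h)

theorem and_mem : φ.and ψ ∈ w.carrier ↔ φ ∈ w.carrier ∧ ψ ∈ w.carrier := by
  refine ⟨fun h => ⟨?_, ?_⟩, fun ⟨h₁, h₂⟩ => ?_⟩
  · refine w.mem_of_deriv (.mp (.of_isTautology (φ := (φ.and ψ).imp φ) ?_) (.prem h))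
    intro v hn ha
    simp only [Formula.imp, Formula.or, hn, ha]
    cases v φ <;> cases v ψ <;> rfl
  · refine w.mem_of_deriv (.mp (.of_isTautology (φ := (φ.and ψ).imp ψ) ?_) (.prem h))
    intro v hn ha
    simp only [Formula.imp, Formula.or, hn, ha]
    cases v φ <;> cases v ψ <;> rfl
  · refine w.mem_of_deriv (.mp (.mp (.of_isTautology (φ := φ.imp (ψ.imp (φ.and ψ))) ?_)
      (.prem h₁)) (.prem h₂))
    intro v hn ha
    simp only [Formula.imp, Formula.or, hn, ha]
    cases v φ <;> cases v ψ <;> rfl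

theorem or_mem : φ.or ψ ∈ w.carrier ↔ φ ∈ w.carrier ∨ ψ ∈ w.carrier := by
  rw [Formula.or, w.neg_mem, w.and_mem, w.neg_mem, w.neg_mem]
  tauto

theorem imp_mem : φ.imp ψ ∈ w.carrier ↔ (φ ∈ w.carrier → ψ ∈ w.carrier) := by
  rw [Formula.imp, w.or_mem, w.neg_mem]
  tauto

theorem biimp_mem : φ.biimp ψ ∈ w.carrier ↔ (φ ∈ w.carrier ↔ ψ ∈ w.carrier) := by
  rw [Formula.biimp, w.and_mem, w.imp_mem, w.imp_mem]
  tauto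

theorem delta_mem : φ.delta ∈ w.carrier ↔ φ.nabla ∉ w.carrier := w.neg_mem

theorem circ_mem : φ.circ ∈ w.carrier ↔ φ.bullet ∉ w.carrier := w.neg_mem

theorem prf_of_forall_mem (h : ∀ w : MaxConsistent Ax, φ ∈ w.carrier) : Prf Ax φ := by
  by_contra hφ
  obtain ⟨w, -, hw⟩ := exists_of_not_deriv (Γ := ∅) (fun d : Deriv Ax ∅ φ => hφ d.prf)
  exact hw (h w)

theorem nabla_congr (h : ∀ u : MaxConsistent Ax, φ ∈ u.carrier ↔ ψ ∈ u.carrier) :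
    φ.nabla ∈ w.carrier ↔ ψ.nabla ∈ w.carrier :=
  w.biimp_mem.1 (w.mem_of_prf (.reN (prf_of_forall_mem fun u => u.biimp_mem.2 (h u))))

theorem bullet_congr (h : ∀ u : MaxConsistent Ax, φ ∈ u.carrier ↔ ψ ∈ u.carrier) :
    φ.bullet ∈ w.carrier ↔ ψ.bullet ∈ w.carrier :=
  w.biimp_mem.1 (w.mem_of_prf (.reB (prf_of_forall_mem fun u => u.biimp_mem.2 (h u))))

theorem nabla_neg_mem : φ.neg.nabla ∈ w.carrier ↔ φ.nabla ∈ w.carrier :=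
  (w.biimp_mem.1 (w.mem_of_prf (.e1 φ))).symm

theorem mem_of_bullet_mem (h : φ.bullet ∈ w.carrier) : φ ∈ w.carrier :=
  w.imp_mem.1 (w.mem_of_prf (.e2 φ)) h

/-- The truth set of `φ` in the canonical model. -/
def proofSet (Ax : Set Formula) (φ : Formula) : Set (MaxConsistent Ax) :=
  {w | φ ∈ w.carrier}

/-- `φ` is necessary at `w`: every weakening of `φ` is both non-contingent and
non-accidental. -/
def Necessary (φ : Formula) : Prop :=
  ∀ ψ : Formula, (φ.or ψ).nabla ∉ w.carrier ∧ (φ.or ψ).bullet ∉ w.carrier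

variable {w}

theorem Necessary.mono (hφ : w.Necessary φ) (h : proofSet Ax φ ⊆ proofSet Ax ψ) :
    w.Necessary ψ := by
  intro χ
  have hiff : ∀ u : MaxConsistent Ax,
      ψ.or χ ∈ u.carrier ↔ φ.or (ψ.or χ) ∈ u.carrier := by
    intro u
    have : φ ∈ u.carrier → ψ ∈ u.carrier := @h u
    simp only [or_mem]
    tauto
  rw [w.nabla_congr hiff, w.bullet_congr hiff]
  exact hφ _

theorem Necessary.nabla_notMem (h : w.Necessary φ) : φ.nabla ∉ w.carrier := by
  rw [w.nabla_congr (ψ := φ.or φ) fun u => by rw [or_mem, or_self]]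
  exact (h φ).1

theorem Necessary.bullet_notMem (h : w.Necessary φ) : φ.bullet ∉ w.carrier := by
  rw [w.bullet_congr (ψ := φ.or φ) fun u => by rw [or_mem, or_self]]
  exact (h φ).2

end MaxConsistent

namespace MaxConsistent

variable {φ ψ : Formula} {w : MaxConsistent KAx}

theorem necessary_of_bullet_notMem (hφ : φ ∈ w.carrier) (h : φ.bullet ∉ w.carrier) :
    w.Necessary φ := by
  intro ψ
  have hax := w.imp_mem.1 (w.mem_of_prf (.ax (.inl (.inl (.inl (.inr ⟨φ, ψ, rfl⟩))))))
    (w.and_mem.2 ⟨w.circ_mem.2 h, hφ⟩)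
  rwa [w.and_mem, w.delta_mem, w.circ_mem] at hax

theorem Necessary.and (hφ : w.Necessary φ) (hψ : w.Necessary ψ) : w.Necessary (φ.and ψ) := by
  intro χ
  have hiff : ∀ u : MaxConsistent KAx,
      (φ.and ψ).or χ ∈ u.carrier ↔ (φ.or χ).and (ψ.or χ) ∈ u.carrier := by
    intro u
    simp only [or_mem, and_mem]
    tauto
  rw [w.nabla_congr hiff, w.bullet_congr hiff, ← w.delta_mem, ← w.circ_mem]
  exact ⟨w.imp_mem.1 (w.mem_of_prf (.ax (.inl (.inl (.inr ⟨_, _, rfl⟩)))))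
      (w.and_mem.2 ⟨w.delta_mem.2 (hφ χ).1, w.delta_mem.2 (hψ χ).1⟩),
    w.imp_mem.1 (w.mem_of_prf (.ax (.inl (.inr ⟨_, _, rfl⟩))))
      (w.and_mem.2 ⟨w.circ_mem.2 (hφ χ).2, w.circ_mem.2 (hψ χ).2⟩)⟩

theorem top_mem : Formula.top ∈ w.carrier := w.imp_mem.2 id

theorem necessary_top : w.Necessary Formula.top :=
  necessary_of_bullet_notMem top_mem (w.neg_mem.1 (w.mem_of_prf (.ax (.inr rfl))))

theorem necessary_or_necessary_neg (h : φ.nabla ∉ w.carrier) :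
    w.Necessary φ ∨ w.Necessary φ.neg := by
  have hM1 (ψ χ : Formula) : (φ.or ψ).nabla ∈ w.carrier → (φ.neg.or χ).nabla ∉ w.carrier :=
    fun h₁ h₂ => h (w.imp_mem.1 (w.mem_of_prf
      (.ax (.inl (.inl (.inl (.inl (.inl (.inl ⟨φ, ψ, χ, rfl⟩)))))))) (w.and_mem.2 ⟨h₁, h₂⟩))
  have hM2 (ψ χ : Formula) : (φ.or ψ).bullet ∈ w.carrier → (φ.neg.or χ).bullet ∉ w.carrier :=
    fun h₁ h₂ => h (w.imp_mem.1 (w.mem_of_prf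
      (.ax (.inl (.inl (.inl (.inl (.inl (.inr ⟨φ, ψ, χ, rfl⟩)))))))) (w.and_mem.2 ⟨h₁, h₂⟩))
  have hM3 (θ ψ χ : Formula) (hθ : θ.nabla ∉ w.carrier) :
      (θ.or ψ).bullet ∈ w.carrier → (θ.neg.or χ).nabla ∉ w.carrier :=
    fun h₁ h₂ => hθ (w.imp_mem.1 (w.mem_of_prf
      (.ax (.inl (.inl (.inl (.inl (.inr ⟨θ, ψ, χ, rfl⟩))))))) (w.and_mem.2 ⟨h₁, h₂⟩))
  have hM3' (ψ χ : Formula) : (φ.or ψ).nabla ∈ w.carrier → (φ.neg.or χ).bullet ∉ w.carrier := by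
    intro h₁ h₂
    refine hM3 φ.neg χ ψ (mt w.nabla_neg_mem.1 h) h₂ ((w.nabla_congr fun u => ?_).1 h₁)
    simp only [or_mem, neg_mem, not_not]
  by_contra! hc
  simp only [Necessary, not_forall] at hc
  obtain ⟨⟨ψ, hψ⟩, χ, hχ⟩ := hc
  have h1 := hM1 ψ χ
  have h2 := hM2 ψ χ
  have h3 := hM3 φ ψ χ h
  have h4 := hM3' ψ χ
  tauto

end MaxConsistent

/-- The supplementation of the canonical model of the system with extra axioms `Ax`. -/
def canonicalModel {Ax : Set Formula} (w : MaxConsistent Ax) : NbhdModel where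
  S := MaxConsistent Ax
  ne := ⟨w⟩
  N u := {X | ∃ φ, u.Necessary φ ∧ MaxConsistent.proofSet Ax φ ⊆ X}
  V p := MaxConsistent.proofSet Ax (.atom p)

namespace canonicalModel

open MaxConsistent

theorem proofSet_mem_N {Ax : Set Formula} {w u : MaxConsistent Ax} {φ : Formula} :
    proofSet Ax φ ∈ (canonicalModel w).N u ↔ u.Necessary φ :=
  ⟨fun ⟨_, hψ, hsub⟩ => hψ.mono hsub, fun h => ⟨φ, h, subset_rfl⟩⟩

theorem compl_proofSet {Ax : Set Formula} (φ : Formula) :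
    (proofSet Ax φ)ᶜ = proofSet Ax φ.neg :=
  Set.ext fun u => u.neg_mem.symm

variable (w : MaxConsistent KAx)

theorem propN : (canonicalModel w).PropN :=
  fun _ => ⟨.top, necessary_top, Set.subset_univ _⟩

theorem propS : (canonicalModel w).PropS :=
  fun _ _ _ ⟨φ, hφ, hsub⟩ hXY => ⟨φ, hφ, hsub.trans hXY⟩

theorem propI : (canonicalModel w).PropI :=
  fun _ _ _ ⟨φ, hφ, hX⟩ ⟨ψ, hψ, hY⟩ => ⟨φ.and ψ, hφ.and hψ, fun u hu =>
    have h := u.and_mem.1 hu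
    ⟨hX h.1, hY h.2⟩⟩

/-- The truth lemma. -/
theorem truthSet_eq (φ : Formula) : (canonicalModel w).truthSet φ = proofSet KAx φ := by
  induction φ with
  | atom p => rfl
  | neg φ ih =>
    rw [NbhdModel.truthSet, ih]
    exact compl_proofSet φ
  | and φ ψ ihφ ihψ =>
    rw [NbhdModel.truthSet, ihφ, ihψ]
    exact Set.ext fun u => u.and_mem.symm
  | nabla φ ih =>
    rw [NbhdModel.truthSet, ih]
    refine Set.ext fun (u : MaxConsistent KAx) => ?_
    have hneg : (proofSet KAx φ)ᶜ ∈ (canonicalModel w).N u ↔ u.Necessary φ.neg :=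
      compl_proofSet φ ▸ proofSet_mem_N
    refine (and_congr (not_congr proofSet_mem_N) (not_congr hneg)).trans ?_
    rw [← not_or, not_iff_comm]
    exact ⟨necessary_or_necessary_neg,
      fun h => h.elim Necessary.nabla_notMem fun h => mt u.nabla_neg_mem.2 h.nabla_notMem⟩
  | bullet φ ih =>
    rw [NbhdModel.truthSet, ih]
    refine Set.ext fun (u : MaxConsistent KAx) => ?_
    refine (and_congr_right' (not_congr proofSet_mem_N)).trans ?_
    exact ⟨fun ⟨hφ, hN⟩ => by_contra fun h => hN (necessary_of_bullet_notMem hφ h),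
      fun h => ⟨u.mem_of_bullet_mem h, fun hN => hN.bullet_notMem h⟩⟩

end canonicalModel

namespace NbhdModel

variable {M : NbhdModel} {s : M.S} {φ ψ : Formula}

theorem sat_neg : M.Sat s φ.neg ↔ ¬ M.Sat s φ := Iff.rfl

theorem sat_and : M.Sat s (φ.and ψ) ↔ M.Sat s φ ∧ M.Sat s ψ := Iff.rfl

theorem sat_nabla : M.Sat s φ.nabla ↔
    M.truthSet φ ∉ M.N s ∧ (M.truthSet φ)ᶜ ∉ M.N s := Iff.rfl

theorem sat_bullet : M.Sat s φ.bullet ↔ M.Sat s φ ∧ M.truthSet φ ∉ M.N s := Iff.rfl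

theorem sat_or : M.Sat s (φ.or ψ) ↔ M.Sat s φ ∨ M.Sat s ψ := by
  rw [Formula.or, sat_neg, sat_and, sat_neg, sat_neg]
  tauto

theorem sat_imp : M.Sat s (φ.imp ψ) ↔ (M.Sat s φ → M.Sat s ψ) := by
  rw [Formula.imp, sat_or, sat_neg]
  tauto

theorem sat_biimp : M.Sat s (φ.biimp ψ) ↔ (M.Sat s φ ↔ M.Sat s ψ) := by
  rw [Formula.biimp, sat_and, sat_imp, sat_imp]
  tauto

theorem truthSet_or : M.truthSet (φ.or ψ) = M.truthSet φ ∪ M.truthSet ψ :=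
  Set.ext fun _ => sat_or

theorem truthSet_top : M.truthSet .top = Set.univ :=
  Set.eq_univ_of_forall fun _ => sat_imp.2 id

theorem sat_of_isTautology (h : IsTautology φ) : M.Sat s φ := by
  classical
  have := h (fun ψ => decide (M.Sat s ψ)) (fun ψ => by simp [sat_neg])
    (fun ψ χ => by simp [sat_and])
  simpa using this

theorem sat_of_mem_KAx (hN : M.PropN) (hI : M.PropI) (hS : M.PropS) (h : φ ∈ KAx) (s : M.S) :
    M.Sat s φ := by
  have hor {α β : Formula} (hα : M.truthSet α ∈ M.N s) : M.truthSet (α.or β) ∈ M.N s :=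
    hS s _ _ hα (truthSet_or ▸ Set.subset_union_left)
  rcases h with (((((⟨φ, ψ, χ, rfl⟩ | ⟨φ, ψ, χ, rfl⟩) | ⟨φ, ψ, χ, rfl⟩) | ⟨φ, ψ, rfl⟩) |
    ⟨φ, ψ, rfl⟩) | ⟨φ, ψ, rfl⟩) | rfl
  · rw [sat_imp, sat_and]
    exact fun h => ⟨fun hφ => h.1.1 (hor hφ), fun hφ => h.2.1 (hor hφ)⟩
  · rw [sat_imp, sat_and]
    exact fun h => ⟨fun hφ => h.1.2 (hor hφ), fun hφ => h.2.2 (hor hφ)⟩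
  · rw [sat_imp, sat_and]
    exact fun h => ⟨fun hφ => h.1.2 (hor hφ), fun hφ => h.2.1 (hor hφ)⟩
  · rw [sat_imp, sat_and, sat_and]
    intro ⟨hc, hφ⟩
    have hmem : M.truthSet φ ∈ M.N s := by_contra fun h => hc ⟨hφ, h⟩
    exact ⟨fun h => h.1 (hor hmem), fun h => h.2 (hor hmem)⟩
  · rw [sat_imp, sat_and]
    rintro ⟨hφ, hψ⟩ ⟨h₁, h₂⟩
    refine hφ ⟨fun hφ' => hψ ⟨fun hψ' => h₁ (hI s _ _ hφ' hψ'), fun hψ' => h₂ ?_⟩, fun hφ' => h₂ ?_⟩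
    · exact hS s _ _ hψ' (Set.compl_subset_compl.2 Set.inter_subset_right)
    · exact hS s _ _ hφ' (Set.compl_subset_compl.2 Set.inter_subset_left)
  · rw [sat_imp, sat_and]
    rintro ⟨hφ, hψ⟩ ⟨⟨h₁, h₂⟩, h₃⟩
    exact hφ ⟨h₁, fun hφ' => hψ ⟨h₂, fun hψ' => h₃ (hI s _ _ hφ' hψ')⟩⟩
  · exact fun h => h.2 (truthSet_top ▸ hN s)

theorem sat_of_prf {Ax : Set Formula} (hAx : ∀ α ∈ Ax, ∀ s, M.Sat s α) (h : Prf Ax φ) (s : M.S) :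
    M.Sat s φ := by
  induction h generalizing s with
  | taut h => exact sat_of_isTautology h
  | e1 φ =>
    rw [sat_biimp, sat_nabla, sat_nabla, truthSet, compl_compl, and_comm]
  | e2 φ => exact sat_imp.2 fun h => h.1
  | e3 φ =>
    rw [sat_imp, sat_or]
    intro h
    by_cases hs : M.Sat s φ
    · exact .inl ⟨hs, h.1⟩
    · exact .inr ⟨hs, h.2⟩
  | ax h => exact hAx _ h s
  | mp _ _ ih₁ ih₂ => exact sat_imp.1 (ih₁ s) (ih₂ s)
  | @reN φ ψ _ ih =>
    have heq : M.truthSet φ = M.truthSet ψ := Set.ext fun s => sat_biimp.1 (ih s)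
    rw [sat_biimp, sat_nabla, sat_nabla, heq]
  | @reB φ ψ _ ih =>
    have heq : M.truthSet φ = M.truthSet ψ := Set.ext fun s => sat_biimp.1 (ih s)
    rw [sat_biimp, sat_bullet, sat_bullet, Sat, Sat, heq]

end NbhdModel

/-- K^{∇•} is sound and strongly complete with respect to the
class of filters. -/
theorem K_sound_and_strongly_complete (Γ : Set Formula) (φ : Formula) :
    Deriv KAx Γ φ ↔
      ∀ (M : NbhdModel), M.PropN → M.PropI → M.PropS →
        ∀ s : M.S, (∀ γ ∈ Γ, M.Sat s γ) → M.Sat s φ := by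
  constructor
  · intro d M hN hI hS s hΓ
    induction d with
    | thm h => exact NbhdModel.sat_of_prf (fun _ => NbhdModel.sat_of_mem_KAx hN hI hS) h s
    | prem h => exact hΓ _ h
    | mp _ _ ih₁ ih₂ => exact NbhdModel.sat_imp.1 ih₁ ih₂
  · intro h
    by_contra hd
    obtain ⟨w, hΓ, hφ⟩ := MaxConsistent.exists_of_not_deriv hd
    have hsat (ψ : Formula) : (canonicalModel w).Sat w ψ ↔ ψ ∈ w.carrier :=
      Set.ext_iff.1 (canonicalModel.truthSet_eq w ψ) w
    exact hφ ((hsat φ).1 (h _ (canonicalModel.propN w) (canonicalModel.propI w)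
      (canonicalModel.propS w) w fun γ hγ => (hsat γ).2 (hΓ hγ)))
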